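/- Direct part of quantum Stein's lemma: Let ρ and σ be density matrices on ℂ^k with σ positive definite. For every λ < D(ρ‖σ) there exists a sequence of tests A^n on (ℂ^k)^{⊗n} (operators with 0 ≤ A^n ≤ I) such that Tr(ρ^{⊗n}(I − A^n)) → 0 as n → ∞ and limsup_{n→∞} (1/n) log Tr(σ^{⊗n} A^n) ≤ −λ. -/

import Mathlib

open scoped BigOperators Classical ComplexOrder
open Matrix Filter

noncomputable def matFun {d : Type*} [Fintype d] [DecidableEq d] (f : ℝ → ℝ)
    (A : Matrix d d ℂ) : Matrix d d ℂ :=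
  if hA : A.IsHermitian then hA.cfc f else 0

noncomputable def matLog {d : Type*} [Fintype d] [DecidableEq d]
    (A : Matrix d d ℂ) : Matrix d d ℂ :=
  matFun Real.log A

noncomputable def tensPow {k : ℕ} (ρ : Matrix (Fin k) (Fin k) ℂ) (n : ℕ) :
    Matrix (Fin n → Fin k) (Fin n → Fin k) ℂ :=
  fun x y => ∏ i, ρ (x i) (y i)

structure IsPVM {d ι : Type*} [Fintype d] [DecidableEq d] [Fintype ι]
    (E : ι → Matrix d d ℂ) : Prop where
  herm : ∀ i, (E i).IsHermitian
  idem : ∀ i, E i * E i = E i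
  ne_zero : ∀ i, E i ≠ 0
  orth : ∀ i j, i ≠ j → E i * E j = 0
  sum_one : ∑ i, E i = 1

noncomputable def pvmWidth {d ι : Type*} [Fintype d] [DecidableEq d] [Fintype ι]
    (E : ι → Matrix d d ℂ) : ℕ :=
  Finset.univ.sup fun i => (E i).rank

def Refines {d ι κ : Type*} [Fintype d] [DecidableEq d] [Fintype ι] [Fintype κ]
    (M : κ → Matrix d d ℂ) (E : ι → Matrix d d ℂ) : Prop :=
  ∃ f : κ → ι, ∀ i, E i = ∑ j ∈ Finset.univ.filter (fun j => f j = i), M j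

def IsTest {d : Type*} [Fintype d] [DecidableEq d] (A : Matrix d d ℂ) : Prop :=
  A.PosSemidef ∧ (1 - A).PosSemidef

noncomputable def pinch {d ι : Type*} [Fintype d] [DecidableEq d] [Fintype ι]
    (E : ι → Matrix d d ℂ) (A : Matrix d d ℂ) : Matrix d d ℂ :=
  ∑ i, E i * A * E i

/-- Quantum relative entropy `D(ρ‖σ) = Tr ρ (log ρ - log σ)`. -/
noncomputable def qRelEnt {d : Type*} [Fintype d] [DecidableEq d]
    (ρ σ : Matrix d d ℂ) : ℝ :=
  (Matrix.trace (ρ * (matLog ρ - matLog σ))).re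

/-- The matrix `U diag(f) Uᴴ`. -/
noncomputable def conjDiag {d : Type*} [Fintype d] [DecidableEq d] (U : Matrix d d ℂ)
    (f : d → ℝ) : Matrix d d ℂ :=
  U * diagonal (fun i => (f i : ℂ)) * Uᴴ

section ConjDiag

variable {d : Type*} [Fintype d] [DecidableEq d] {U : Matrix d d ℂ}

lemma posSemidef_conjDiag (U : Matrix d d ℂ) {f : d → ℝ} (hf : ∀ i, 0 ≤ f i) :
    (conjDiag U f).PosSemidef :=
  (PosSemidef.diagonal (fun i => by simpa using hf i)).mul_mul_conjTranspose_same U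

lemma conjDiag_mul (hU : Uᴴ * U = 1) (f g : d → ℝ) :
    conjDiag U f * conjDiag U g = conjDiag U (fun i => f i * g i) := by
  have : conjDiag U f * conjDiag U g
      = U * diagonal (fun i => (f i : ℂ)) * (Uᴴ * U) * diagonal (fun i => (g i : ℂ)) * Uᴴ := by
    simp only [conjDiag, Matrix.mul_assoc]
  rw [this, hU, Matrix.mul_one, Matrix.mul_assoc U, diagonal_mul_diagonal]
  simp [conjDiag]

lemma conjDiag_sub (U : Matrix d d ℂ) (f g : d → ℝ) :
    conjDiag U f - conjDiag U g = conjDiag U (fun i => f i - g i) := by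
  simp only [conjDiag, ← Matrix.sub_mul, ← Matrix.mul_sub, diagonal_sub, Complex.ofReal_sub]

lemma conjDiag_const (hU : Uᴴ * U = 1) (c : ℝ) : conjDiag U (fun _ => c) = (c : ℂ) • 1 := by
  have : diagonal (fun _ : d => (c : ℂ)) = (c : ℂ) • (1 : Matrix d d ℂ) := by
    rw [smul_one_eq_diagonal]
  simp [conjDiag, this, mul_eq_one_comm.mp hU]

lemma trace_mul_conjDiag_re (ρ U : Matrix d d ℂ) (f : d → ℝ) :
    (ρ * conjDiag U f).trace.re = ∑ i, ((Uᴴ * ρ * U) i i).re * f i := by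
  have : (ρ * conjDiag U f).trace = (Uᴴ * ρ * U * diagonal (fun i => (f i : ℂ))).trace := by
    rw [conjDiag, ← Matrix.mul_assoc, trace_mul_comm]
    simp only [Matrix.mul_assoc]
  rw [this]
  simp [Matrix.trace, mul_diagonal]

lemma trace_conjDiag_re (hU : Uᴴ * U = 1) (f : d → ℝ) :
    (conjDiag U f).trace.re = ∑ i, f i := by
  have := trace_mul_conjDiag_re 1 U f
  simpa [hU] using this

/-- Simultaneous form of the spectral theorem and of the functional calculus. -/
lemma exists_conjDiag {A : Matrix d d ℂ} (hA : A.IsHermitian) :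
    ∃ U : Matrix d d ℂ, Uᴴ * U = 1 ∧ A = conjDiag U hA.eigenvalues ∧
      ∀ f, matFun f A = conjDiag U (fun i => f (hA.eigenvalues i)) := by
  refine ⟨hA.eigenvectorUnitary, ?_, ?_, fun f => ?_⟩
  · exact (Unitary.mem_iff.mp hA.eigenvectorUnitary.2).1
  · conv_lhs => rw [hA.spectral_theorem]
    rfl
  · rw [matFun, dif_pos hA]
    rfl

lemma trace_mul_re_nonneg {A B : Matrix d d ℂ} (hA : A.PosSemidef) (hB : B.PosSemidef) :
    0 ≤ (A * B).trace.re := by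
  obtain ⟨U, -, hU, -⟩ := exists_conjDiag hB.1
  rw [hU, trace_mul_conjDiag_re]
  exact Finset.sum_nonneg fun i _ => mul_nonneg
    (Complex.nonneg_iff.mp (hA.conjTranspose_mul_mul_same U).diag_nonneg).1
    (hB.eigenvalues_nonneg i)

/-- The test `Q P Q` for projections `P`, `Q`, the first of which commutes with the state,
fails with probability at most that of `P` plus twice that of `Q`. -/
lemma trace_one_sub_mul_mul_le {ρ P Q : Matrix d d ℂ} (hρ : ρ.PosSemidef)
    (hP : P.PosSemidef) (hPP : P * P = P) (hρP : ρ * P = P * ρ)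
    (hQ' : (1 - Q).PosSemidef) (hQQ : Q * Q = Q) :
    (ρ * (1 - Q * P * Q)).trace.re ≤
      (ρ * (1 - P)).trace.re + 2 * (ρ * (1 - Q)).trace.re := by
  obtain ⟨S, rfl⟩ : ∃ S, P = 1 - S := ⟨1 - P, by simp⟩
  obtain ⟨R, rfl⟩ : ∃ R, Q = 1 - R := ⟨1 - Q, by simp⟩
  rw [sub_sub_cancel] at hQ'
  have hSS : S * S = S := by
    have : S * S - S = (1 - S) * (1 - S) - (1 - S) := by noncomm_ring
    rw [hPP, sub_self] at this
    exact sub_eq_zero.mp this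
  have hRR : R * R = R := by
    have : R * R - R = (1 - R) * (1 - R) - (1 - R) := by noncomm_ring
    rw [hQQ, sub_self] at this
    exact sub_eq_zero.mp this
  have hρS : ρ * S = S * ρ := by simpa [Matrix.mul_sub, Matrix.sub_mul] using hρP
  have hSH : Sᴴ = S := by simpa using hP.1.eq
  have hSρS : S * ρ * S = ρ * S := by rw [← hρS, Matrix.mul_assoc, hSS]
  have hρS_psd : (ρ * S).PosSemidef := by
    have := hρ.mul_mul_conjTranspose_same S
    rwa [hSH, hSρS] at this
  have cross : 0 ≤ (ρ * S * R).trace.re := trace_mul_re_nonneg hρS_psd hQ'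
  have cross' : (ρ * R * S).trace = (ρ * S * R).trace := by
    rw [trace_mul_comm, ← Matrix.mul_assoc, ← hρS]
  have quad : 0 ≤ (ρ * (R * (1 - S) * R)).trace.re := by
    have := hP.mul_mul_conjTranspose_same R
    rw [hQ'.1.eq] at this
    exact trace_mul_re_nonneg hρ this
  have key : ρ * (1 - (1 - R) * (1 - S) * (1 - R)) + ρ * (R * (1 - S) * R)
      + ρ * S * R + ρ * R * S = ρ * (1 - (1 - S)) + ρ * (1 - (1 - R)) + ρ * (1 - (1 - R)) := by
    have : ρ * (1 - (1 - R) * (1 - S) * (1 - R)) + ρ * (R * (1 - S) * R)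
      + ρ * S * R + ρ * R * S = ρ * S + ρ * R + ρ * R := by noncomm_ring
    rw [this]
    noncomm_ring
  have key' := congrArg (fun M => M.trace.re) key
  simp only [trace_add, Complex.add_re, cross'] at key'
  linarith

end ConjDiag

section TensPow

variable {k : ℕ}

lemma tensPow_mul (A B : Matrix (Fin k) (Fin k) ℂ) (n : ℕ) :
    tensPow (A * B) n = tensPow A n * tensPow B n := by
  ext x y
  simp only [tensPow, mul_apply, Finset.prod_univ_sum, Fintype.piFinset_univ,
    Finset.prod_mul_distrib]

lemma tensPow_diagonal (f : Fin k → ℂ) (n : ℕ) :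
    tensPow (diagonal f) n = diagonal (fun x => ∏ i, f (x i)) := by
  ext x y
  by_cases h : x = y
  · simp [tensPow, h]
  · obtain ⟨i, hi⟩ := Function.ne_iff.mp h
    rw [diagonal_apply_ne _ h]
    exact Finset.prod_eq_zero (Finset.mem_univ i) (diagonal_apply_ne _ hi)

lemma tensPow_one (n : ℕ) : tensPow (1 : Matrix (Fin k) (Fin k) ℂ) n = 1 := by
  simpa using tensPow_diagonal (fun _ : Fin k => (1 : ℂ)) n

lemma tensPow_conjTranspose (A : Matrix (Fin k) (Fin k) ℂ) (n : ℕ) :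
    tensPow Aᴴ n = (tensPow A n)ᴴ := by
  ext x y
  simp [tensPow, conjTranspose_apply]

lemma tensPow_isometry {U : Matrix (Fin k) (Fin k) ℂ} (hU : Uᴴ * U = 1) (n : ℕ) :
    (tensPow U n)ᴴ * tensPow U n = 1 := by
  rw [← tensPow_conjTranspose, ← tensPow_mul, hU, tensPow_one]

lemma tensPow_conjDiag (U : Matrix (Fin k) (Fin k) ℂ) (f : Fin k → ℝ) (n : ℕ) :
    tensPow (conjDiag U f) n = conjDiag (tensPow U n) (fun x => ∏ i, f (x i)) := by
  simp [conjDiag, tensPow_mul, tensPow_diagonal, tensPow_conjTranspose]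

/-- A weighted mean of exponentials with negative mean exponent drops below one. -/
lemma exists_sum_mul_exp_lt_one {ι : Type*} [Fintype ι] (w g : ι → ℝ) (hw1 : ∑ i, w i = 1)
    (hg : ∑ i, w i * g i < 0) : ∃ t : ℝ, 0 < t ∧ ∑ i, w i * Real.exp (t * g i) < 1 := by
  have hd : HasDerivAt (fun t : ℝ => ∑ i, w i * Real.exp (t * g i)) (∑ i, w i * g i) 0 := by
    refine HasDerivAt.fun_sum fun i _ => ?_
    have := (((hasDerivAt_id (0 : ℝ)).mul_const (g i)).exp).const_mul (w i)
    simpa using this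
  have hs := (hasDerivAt_iff_tendsto_slope.mp hd).eventually (gt_mem_nhds hg)
  have hs' := hs.filter_mono (nhdsGT_le_nhdsNE (0 : ℝ))
  obtain ⟨t, ht, ht0⟩ := (hs'.and self_mem_nhdsWithin).exists
  have ht0 : 0 < t := ht0
  refine ⟨t, ht0, ?_⟩
  rw [slope_def_field, sub_zero] at ht
  have := (div_lt_iff₀ ht0).mp ht
  simp only [zero_mul, Real.exp_zero, mul_one, hw1] at this
  linarith

/-- Chernoff's bound: sums of independent variables of negative mean are nonnegative with
vanishing probability. -/
lemma tendsto_sum_tail {ι : Type*} [Fintype ι] (w g : ι → ℝ) (hw : ∀ i, 0 ≤ w i)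
    (hw1 : ∑ i, w i = 1) (hg : ∑ i, w i * g i < 0) :
    Tendsto (fun n : ℕ => ∑ x : Fin n → ι, if 0 ≤ ∑ i, g (x i) then ∏ i, w (x i) else 0)
      atTop (nhds 0) := by
  obtain ⟨t, ht, hlt⟩ := exists_sum_mul_exp_lt_one w g hw1 hg
  have h0 : 0 ≤ ∑ i, w i * Real.exp (t * g i) :=
    Finset.sum_nonneg fun i _ => mul_nonneg (hw i) (Real.exp_pos _).le
  refine squeeze_zero (fun n => ?_) (fun n => ?_) (tendsto_pow_atTop_nhds_zero_of_lt_one h0 hlt)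
  · refine Finset.sum_nonneg fun x _ => ?_
    split_ifs
    · exact Finset.prod_nonneg fun i _ => hw _
    · exact le_rfl
  · rw [Fintype.sum_pow]
    refine Finset.sum_le_sum fun x _ => ?_
    have hp : 0 ≤ ∏ i, w (x i) := Finset.prod_nonneg fun i _ => hw _
    rw [Finset.prod_mul_distrib, ← Real.exp_sum, ← Finset.mul_sum]
    split_ifs with h
    · exact le_mul_of_one_le_right hp (Real.one_le_exp (mul_nonneg ht.le h))
    · exact mul_nonneg hp (Real.exp_pos _).le

/-- The distribution of the outcomes of measuring `ρ` in the basis `U`. -/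
noncomputable def outcomeProb (ρ U : Matrix (Fin k) (Fin k) ℂ) (j : Fin k) : ℝ :=
  ((Uᴴ * ρ * U) j j).re

lemma outcomeProb_nonneg {ρ : Matrix (Fin k) (Fin k) ℂ} (hρ : ρ.PosSemidef)
    (U : Matrix (Fin k) (Fin k) ℂ) (j : Fin k) : 0 ≤ outcomeProb ρ U j :=
  (Complex.nonneg_iff.mp (hρ.conjTranspose_mul_mul_same U).diag_nonneg).1

lemma sum_outcomeProb {ρ U : Matrix (Fin k) (Fin k) ℂ} (hρ1 : ρ.trace = 1) (hU : Uᴴ * U = 1) :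
    ∑ j, outcomeProb ρ U j = 1 := by
  have h := trace_mul_conjDiag_re ρ U (fun _ => 1)
  simpa [outcomeProb, conjDiag_const hU, hρ1] using h.symm

lemma outcomeProb_conjDiag {U : Matrix (Fin k) (Fin k) ℂ} (hU : Uᴴ * U = 1) (f : Fin k → ℝ) :
    outcomeProb (conjDiag U f) U = f := by
  have : Uᴴ * conjDiag U f * U = (Uᴴ * U) * diagonal (fun i => (f i : ℂ)) * (Uᴴ * U) := by
    simp only [conjDiag, Matrix.mul_assoc]
  ext j
  rw [outcomeProb, this, hU]
  simp

lemma trace_tensPow_mul_conjDiag {ρ : Matrix (Fin k) (Fin k) ℂ} (hρ : ρ.PosSemidef)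
    (U : Matrix (Fin k) (Fin k) ℂ) (n : ℕ) (f : (Fin n → Fin k) → ℝ) :
    (tensPow ρ n * conjDiag (tensPow U n) f).trace.re
      = ∑ x, (∏ i, outcomeProb ρ U (x i)) * f x := by
  rw [trace_mul_conjDiag_re, ← tensPow_conjTranspose, ← tensPow_mul, ← tensPow_mul]
  refine Finset.sum_congr rfl fun x _ => ?_
  congr 1
  have : ∀ j, (Uᴴ * ρ * U) j j = (outcomeProb ρ U j : ℂ) := fun j =>
    Complex.ext rfl
      (Complex.nonneg_iff.mp (hρ.conjTranspose_mul_mul_same U).diag_nonneg).2.symm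
  simp only [tensPow, this]
  rw [← Complex.ofReal_prod, Complex.ofReal_re]

/-- The projection onto the span of the product basis vectors indexed by `T`. -/
noncomputable def seqProj (U : Matrix (Fin k) (Fin k) ℂ) {n : ℕ} (T : Set (Fin n → Fin k)) :
    Matrix (Fin n → Fin k) (Fin n → Fin k) ℂ :=
  conjDiag (tensPow U n) (T.indicator 1)

lemma posSemidef_seqProj (U : Matrix (Fin k) (Fin k) ℂ) {n : ℕ} (T : Set (Fin n → Fin k)) :
    (seqProj U T).PosSemidef :=
  posSemidef_conjDiag _ fun _ => Set.indicator_nonneg (fun _ _ => zero_le_one) _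

lemma seqProj_mul_self {U : Matrix (Fin k) (Fin k) ℂ} (hU : Uᴴ * U = 1) {n : ℕ}
    (T : Set (Fin n → Fin k)) : seqProj U T * seqProj U T = seqProj U T := by
  rw [seqProj, conjDiag_mul (tensPow_isometry hU n)]
  congr 1
  ext x
  by_cases h : x ∈ T <;> simp [h]

lemma one_sub_seqProj {U : Matrix (Fin k) (Fin k) ℂ} (hU : Uᴴ * U = 1) {n : ℕ}
    (T : Set (Fin n → Fin k)) : 1 - seqProj U T = seqProj U Tᶜ := by
  have h1 : (1 : Matrix (Fin n → Fin k) (Fin n → Fin k) ℂ)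
      = conjDiag (tensPow U n) (fun _ => 1) := by
    simp [conjDiag_const (tensPow_isometry hU n)]
  rw [seqProj, seqProj, h1, conjDiag_sub]
  congr 1
  ext x
  by_cases h : x ∈ T <;> simp [h]

/-- A sequence of sets containing all outcome sequences with negative sum of scores is
asymptotically certain if the mean score is negative. -/
lemma tendsto_trace_one_sub_seqProj {ρ U : Matrix (Fin k) (Fin k) ℂ} (hρ : ρ.PosSemidef)
    (hρ1 : ρ.trace = 1) (hU : Uᴴ * U = 1) (g : Fin k → ℝ)
    (hg : ∑ j, outcomeProb ρ U j * g j < 0) (T : ∀ n, Set (Fin n → Fin k))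
    (hT : ∀ n, ∀ x ∉ T n, ∏ i, outcomeProb ρ U (x i) ≠ 0 → 0 ≤ ∑ i, g (x i)) :
    Tendsto (fun n => (tensPow ρ n * (1 - seqProj U (T n))).trace.re) atTop (nhds 0) := by
  have hw := outcomeProb_nonneg hρ U
  refine squeeze_zero (fun n => ?_) (fun n => ?_)
    (tendsto_sum_tail _ g hw (sum_outcomeProb hρ1 hU) hg)
  all_goals rw [one_sub_seqProj hU, seqProj, trace_tensPow_mul_conjDiag hρ]
  · exact Finset.sum_nonneg fun x _ => mul_nonneg (Finset.prod_nonneg fun i _ => hw _)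
      (Set.indicator_nonneg (fun _ _ => zero_le_one) _)
  · refine Finset.sum_le_sum fun x _ => ?_
    have hp : 0 ≤ ∏ i, outcomeProb ρ U (x i) := Finset.prod_nonneg fun i _ => hw _
    by_cases hx : x ∈ T n
    · simp only [Set.indicator_of_notMem (Set.notMem_compl_iff.mpr hx), mul_zero]
      split_ifs
      exacts [hp, le_rfl]
    · rw [Set.indicator_of_mem (Set.mem_compl hx), Pi.one_apply, mul_one]
      by_cases h0 : ∏ i, outcomeProb ρ U (x i) = 0
      · simp [h0]
      · rw [if_pos (hT n x hx h0)]

lemma isTest_seqProj_mul_mul {U V : Matrix (Fin k) (Fin k) ℂ} (hU : Uᴴ * U = 1)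
    (hV : Vᴴ * V = 1) {n : ℕ} (S T : Set (Fin n → Fin k)) :
    IsTest (seqProj V T * seqProj U S * seqProj V T) := by
  have hT := (posSemidef_seqProj V T).1.eq
  refine ⟨?_, ?_⟩
  · simpa only [hT] using (posSemidef_seqProj U S).mul_mul_conjTranspose_same (seqProj V T)
  · have h := (posSemidef_seqProj U Sᶜ).mul_mul_conjTranspose_same (seqProj V T)
    rw [hT, ← one_sub_seqProj hU, Matrix.mul_sub, Matrix.sub_mul, Matrix.mul_one,
      seqProj_mul_self hV] at h
    have h' := (posSemidef_seqProj V Tᶜ).add h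
    rwa [← one_sub_seqProj hV, sub_add_sub_cancel] at h'

lemma posSemidef_smul_one_sub_conjDiag {d : Type*} [Fintype d] [DecidableEq d]
    {U : Matrix d d ℂ} (hU : Uᴴ * U = 1) {f : d → ℝ} {c : ℝ} (hf : ∀ i, f i ≤ c) :
    ((c : ℂ) • 1 - conjDiag U f).PosSemidef := by
  rw [← conjDiag_const hU, conjDiag_sub]
  exact posSemidef_conjDiag U fun i => sub_nonneg.mpr (hf i)

lemma trace_conjDiag_mul_le {d : Type*} [Fintype d] [DecidableEq d]
    {U A : Matrix d d ℂ} (hU : Uᴴ * U = 1) (hA : A.PosSemidef) {f : d → ℝ} {c : ℝ}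
    (hf : ∀ i, f i ≤ c) : (conjDiag U f * A).trace.re ≤ c * A.trace.re := by
  have h := trace_mul_re_nonneg (posSemidef_smul_one_sub_conjDiag hU hf) hA
  simp only [Matrix.sub_mul, trace_sub, smul_mul, Matrix.one_mul, trace_smul, smul_eq_mul,
    Complex.sub_re, Complex.re_ofReal_mul] at h
  linarith

lemma le_trace_conjDiag_mul {d : Type*} [Fintype d] [DecidableEq d]
    {U A : Matrix d d ℂ} (hU : Uᴴ * U = 1) (hA : A.PosSemidef) {f : d → ℝ} {c : ℝ}
    (hf : ∀ i, c ≤ f i) : c * A.trace.re ≤ (conjDiag U f * A).trace.re := by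
  have h := trace_conjDiag_mul_le hU hA (f := fun i => -f i) (c := -c)
    fun i => neg_le_neg (hf i)
  have hneg : conjDiag U (fun i => -f i) = -conjDiag U f := by
    have h0 := conjDiag_const hU 0
    rw [Complex.ofReal_zero, zero_smul] at h0
    simpa [h0] using (conjDiag_sub U (fun _ => 0) f).symm
  rw [hneg] at h
  simp only [Matrix.neg_mul, trace_neg, Complex.neg_re] at h
  linarith

lemma trace_tensPow_mul_seqProj_mul_mul_le {V : Matrix (Fin k) (Fin k) ℂ} (hV : Vᴴ * V = 1)
    {s : Fin k → ℝ} {n : ℕ} {T : Set (Fin n → Fin k)} {c : ℝ} (hc : 0 ≤ c)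
    (hT : ∀ x ∈ T, ∏ i, s (x i) ≤ c)
    {P : Matrix (Fin n → Fin k) (Fin n → Fin k) ℂ} (hP : P.PosSemidef) :
    (tensPow (conjDiag V s) n * (seqProj V T * P * seqProj V T)).trace.re ≤ c * P.trace.re := by
  have hW := tensPow_isometry hV n
  have hcyc : (tensPow (conjDiag V s) n * (seqProj V T * P * seqProj V T)).trace
      = (seqProj V T * tensPow (conjDiag V s) n * seqProj V T * P).trace := by
    rw [← Matrix.mul_assoc, trace_mul_comm]
    simp only [Matrix.mul_assoc]
  rw [hcyc, tensPow_conjDiag, seqProj, conjDiag_mul hW, conjDiag_mul hW]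
  refine trace_conjDiag_mul_le hW hP fun x => ?_
  by_cases hx : x ∈ T
  · simpa [hx] using hT x hx
  · simpa [hx] using hc

/-- There are at most `c⁻¹` sequences of probability at least `c`. -/
lemma mul_trace_seqProj_le_one {U : Matrix (Fin k) (Fin k) ℂ} (hU : Uᴴ * U = 1)
    {p : Fin k → ℝ} (hp : ∀ j, 0 ≤ p j) (hp1 : ∑ j, p j = 1) {n : ℕ}
    {S : Set (Fin n → Fin k)} {c : ℝ} (hS : ∀ x ∈ S, c ≤ ∏ i, p (x i)) :
    c * (seqProj U S).trace.re ≤ 1 := by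
  rw [seqProj, trace_conjDiag_re (tensPow_isometry hU n), Finset.mul_sum]
  calc ∑ x, c * S.indicator 1 x ≤ ∑ x : Fin n → Fin k, ∏ i, p (x i) := by
        refine Finset.sum_le_sum fun x _ => ?_
        by_cases hx : x ∈ S
        · simpa [hx] using hS x hx
        · simpa [hx] using Finset.prod_nonneg fun i _ => hp (x i)
    _ = 1 := by rw [← Fintype.sum_pow, hp1, one_pow]

end TensPow

lemma qRelEnt_eq_sum {k : ℕ} {ρ U V : Matrix (Fin k) (Fin k) ℂ}
    {σ : Matrix (Fin k) (Fin k) ℂ} {p s : Fin k → ℝ}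
    (hρ : matLog ρ = conjDiag U (fun j => Real.log (p j)))
    (hσ : matLog σ = conjDiag V (fun j => Real.log (s j))) :
    qRelEnt ρ σ = ∑ j, outcomeProb ρ U j * Real.log (p j)
      - ∑ j, outcomeProb ρ V j * Real.log (s j) := by
  rw [qRelEnt, hρ, hσ, Matrix.mul_sub, trace_sub, Complex.sub_re, trace_mul_conjDiag_re,
    trace_mul_conjDiag_re]
  rfl

lemma sum_mul_sub_const {ι : Type*} [Fintype ι] {w : ι → ℝ} (hw1 : ∑ j, w j = 1)
    (f : ι → ℝ) (c : ℝ) : ∑ j, w j * (f j - c) = ∑ j, w j * f j - c := by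
  simp only [mul_sub, Finset.sum_sub_distrib, ← Finset.sum_mul, hw1, one_mul]


/-- **Direct part of quantum Stein's lemma.** For every `λ < D(ρ‖σ)` there is a sequence
of tests `A n` with first error probability tending to `0` and
`limsup (1/n) log (second error probability) ≤ -λ`. -/
theorem stmt_1 (k : ℕ) (ρ σ : Matrix (Fin k) (Fin k) ℂ)
    (hρ : ρ.PosSemidef) (hρ1 : ρ.trace = 1)
    (hσ : σ.PosDef) (hσ1 : σ.trace = 1)
    (lam : ℝ) (hlam : lam < qRelEnt ρ σ) :
    ∃ A : ∀ n : ℕ, Matrix (Fin n → Fin k) (Fin n → Fin k) ℂ,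
      (∀ n, IsTest (A n)) ∧
      Filter.Tendsto (fun n : ℕ => (Matrix.trace (tensPow ρ n * (1 - A n))).re)
        Filter.atTop (nhds 0) ∧
      Filter.limsup
        (fun n : ℕ => (1 / (n : ℝ)) * Real.log (Matrix.trace (tensPow σ n * A n)).re)
        Filter.atTop ≤ -lam := by
  obtain ⟨U, hU, hρU, hlogρ⟩ := exists_conjDiag hρ.1
  obtain ⟨V, hV, hσV, hlogσ⟩ := exists_conjDiag hσ.1
  have hs : ∀ j, 0 < hσ.1.eigenvalues j := hσ.eigenvalues_pos
  have hD := qRelEnt_eq_sum (hlogρ Real.log) (hlogσ Real.log)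
  generalize hρ.1.eigenvalues = p at *
  generalize hσ.1.eigenvalues = s at *
  have hpU : outcomeProb ρ U = p := by rw [hρU, outcomeProb_conjDiag hU]
  have hp : ∀ j, 0 ≤ p j := hpU ▸ outcomeProb_nonneg hρ U
  have hp1 : ∑ j, p j = 1 := hpU ▸ sum_outcomeProb hρ1 hU
  have hw1 := sum_outcomeProb hρ1 hV
  rw [hpU] at hD
  set a := ∑ j, p j * Real.log (p j)
  set b := ∑ j, outcomeProb ρ V j * Real.log (s j)
  obtain ⟨ε, hε, hlam'⟩ : ∃ ε > 0, -(a - ε) + (b + ε) = -lam :=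
    ⟨(a - b - lam) / 2, by linarith, by ring⟩
  let S : ∀ n : ℕ, Set (Fin n → Fin k) := fun n => {x | Real.exp (n * (a - ε)) ≤ ∏ i, p (x i)}
  let T : ∀ n : ℕ, Set (Fin n → Fin k) := fun n => {x | ∏ i, s (x i) ≤ Real.exp (n * (b + ε))}
  let P := fun n => seqProj U (S n)
  let Q := fun n => seqProj V (T n)
  have hρn : ∀ n, (tensPow ρ n).PosSemidef := fun n => by
    rw [hρU, tensPow_conjDiag]
    exact posSemidef_conjDiag _ fun x => Finset.prod_nonneg fun i _ => hp _
  have htest : ∀ n, IsTest (Q n * P n * Q n) := fun n => isTest_seqProj_mul_mul hU hV _ _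
  have hPlim : Tendsto (fun n => (tensPow ρ n * (1 - P n)).trace.re) atTop (nhds 0) := by
    refine tendsto_trace_one_sub_seqProj hρ hρ1 hU (fun j => -(Real.log (p j) - (a - ε))) ?_ S
      fun n x hx h0 => ?_
    · simp only [mul_neg, Finset.sum_neg_distrib]
      rw [hpU, sum_mul_sub_const hp1]
      linarith
    · rw [hpU] at h0
      have hlt : ∏ i, p (x i) < Real.exp (n * (a - ε)) := not_le.mp hx
      have hpos : 0 < ∏ i, p (x i) :=
        lt_of_le_of_ne (Finset.prod_nonneg fun i _ => hp _) h0.symm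
      have := (Real.log_lt_iff_lt_exp hpos).mpr hlt
      rw [Real.log_prod (fun i _ => Finset.prod_ne_zero_iff.mp h0 i (Finset.mem_univ i))] at this
      simp only [neg_sub, Finset.sum_sub_distrib, Finset.sum_const, Finset.card_univ,
        Fintype.card_fin, nsmul_eq_mul]
      linarith
  have hQlim : Tendsto (fun n => (tensPow ρ n * (1 - Q n)).trace.re) atTop (nhds 0) := by
    refine tendsto_trace_one_sub_seqProj hρ hρ1 hV (fun j => Real.log (s j) - (b + ε)) ?_ T
      fun n x hx _ => ?_
    · rw [sum_mul_sub_const hw1]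
      linarith
    · have hlt : Real.exp (n * (b + ε)) < ∏ i, s (x i) := not_le.mp hx
      have := (Real.lt_log_iff_exp_lt (Finset.prod_pos fun i _ => hs _)).mpr hlt
      rw [Real.log_prod (fun i _ => (hs _).ne')] at this
      simp only [Finset.sum_sub_distrib, Finset.sum_const, Finset.card_univ,
        Fintype.card_fin, nsmul_eq_mul]
      linarith
  have hlim : Tendsto (fun n => (tensPow ρ n * (1 - Q n * P n * Q n)).trace.re) atTop
      (nhds 0) := by
    refine squeeze_zero (fun n => trace_mul_re_nonneg (hρn n) (htest n).2) (fun n => ?_)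
      (by simpa using hPlim.add (hQlim.const_mul 2))
    refine trace_one_sub_mul_mul_le (hρn n) (posSemidef_seqProj _ _) (seqProj_mul_self hU _) ?_
      ?_ (seqProj_mul_self hV _)
    · have hW := tensPow_isometry hU n
      simp only [P, seqProj]
      rw [hρU, tensPow_conjDiag, conjDiag_mul hW, conjDiag_mul hW]
      simp only [mul_comm]
    · simp only [Q]
      rw [one_sub_seqProj hV]
      exact posSemidef_seqProj _ _
  refine ⟨fun n => Q n * P n * Q n, htest, hlim, ?_⟩
  have hupper : ∀ n, (tensPow σ n * (Q n * P n * Q n)).trace.re ≤ Real.exp (n * -lam) := by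
    intro n
    have h₁ := trace_tensPow_mul_seqProj_mul_mul_le hV (s := s) (T := T n)
      (Real.exp_pos (n * (b + ε))).le (fun x hx => hx) (posSemidef_seqProj U (S n))
    have h₂ := mul_trace_seqProj_le_one hU hp hp1 (S := S n) (fun x hx => hx)
    rw [hσV]
    refine h₁.trans ?_
    rw [← hlam', mul_add (n : ℝ) (-(a - ε)), mul_neg, Real.exp_add, mul_comm]
    refine mul_le_mul_of_nonneg_right ?_ (Real.exp_pos _).le
    rw [Real.exp_neg, ← one_div, le_div_iff₀ (Real.exp_pos _), mul_comm]
    exact h₂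
  obtain ⟨m, hm⟩ : ∃ m : ℝ, ∀ j, Real.exp m ≤ s j := by
    obtain ⟨M, hM⟩ := Finite.exists_le (fun j => -Real.log (s j))
    exact ⟨-M, fun j => (Real.le_log_iff_exp_le (hs j)).mp (neg_le.mp (hM j))⟩
  have hlower : ∀ᶠ n : ℕ in atTop,
      Real.exp (n * m) / 2 ≤ (tensPow σ n * (Q n * P n * Q n)).trace.re := by
    filter_upwards [hlim.eventually (gt_mem_nhds (half_pos one_pos))] with n hn
    have htr : (tensPow ρ n).trace.re = 1 := by
      rw [hρU, tensPow_conjDiag, trace_conjDiag_re (tensPow_isometry hU n), ← Fintype.sum_pow,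
        hp1, one_pow]
    have hle : (tensPow ρ n * (Q n * P n * Q n)).trace.re
        ≤ 1 * (Q n * P n * Q n).trace.re := by
      rw [hρU, tensPow_conjDiag]
      refine trace_conjDiag_mul_le (tensPow_isometry hU n) (htest n).1 fun x => ?_
      exact Finset.prod_le_one (fun i _ => hp _) fun i _ =>
        hp1 ▸ Finset.single_le_sum (fun j _ => hp j) (Finset.mem_univ (x i))
    rw [Matrix.mul_sub, Matrix.mul_one, trace_sub, Complex.sub_re, htr] at hn
    have hge : Real.exp (n * m) * (Q n * P n * Q n).trace.re
        ≤ (tensPow σ n * (Q n * P n * Q n)).trace.re := by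
      rw [hσV, tensPow_conjDiag]
      refine le_trace_conjDiag_mul (tensPow_isometry hV n) (htest n).1 fun x => ?_
      rw [Real.exp_nat_mul]
      simpa using Finset.prod_le_prod (s := Finset.univ) (fun _ _ => (Real.exp_pos m).le)
        fun i _ => hm (x i)
    refine le_trans ?_ hge
    rw [div_eq_mul_inv]
    exact mul_le_mul_of_nonneg_left (by linarith) (Real.exp_pos _).le
  have hbelow : ∀ᶠ n : ℕ in atTop,
      m - 1 ≤ 1 / (n : ℝ) * Real.log (tensPow σ n * (Q n * P n * Q n)).trace.re := by
    filter_upwards [hlower, eventually_ge_atTop 1] with n hn h1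
    have h1' : (1 : ℝ) ≤ n := by exact_mod_cast h1
    have hlog := Real.log_le_log (by positivity) hn
    rw [Real.log_div (Real.exp_pos _).ne' two_ne_zero, Real.log_exp] at hlog
    rw [one_div, inv_mul_eq_div, le_div_iff₀ (by linarith)]
    linarith [Real.log_two_lt_d9]
  refine limsup_le_of_le (IsCoboundedUnder.of_frequently_ge hbelow.frequently) ?_
  filter_upwards [hlower, eventually_ge_atTop 1] with n hn h1
  have h1' : (0 : ℝ) < n := by exact_mod_cast h1
  have hlog := Real.log_le_log (lt_of_lt_of_le (by positivity) hn) (hupper n)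
  rw [Real.log_exp] at hlog
  rw [one_div, inv_mul_eq_div, div_le_iff₀ h1']
  linarith
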